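/- arXiv:1511.04740 — 2 statements merged into one kernel-verified Lean document; each statement's English description precedes it below -/
import Mathlib

section
/- The cactus group J_n is generated by the elements s_{1q} for 2 ≤ q ≤ n; that is, the subgroup of J_n generated by the set {s_{1q} : 2 ≤ q ≤ n} is the whole group. -/
/-- The index type of generators `s_{pq}`, `1 ≤ p < q ≤ n`, of the cactus group `J_n`. -/
abbrev CactusGen (n : ℕ) : Type :=
  { pq : ℕ × ℕ // 1 ≤ pq.1 ∧ pq.1 < pq.2 ∧ pq.2 ≤ n }

/-- Constructor for a generator index from `1 ≤ p < q ≤ n`. -/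
def sGen (n p q : ℕ) (h1 : 1 ≤ p) (h2 : p < q) (h3 : q ≤ n) : CactusGen n :=
  ⟨(p, q), h1, h2, h3⟩

/-- The defining relations of the cactus group `J_n`, as relators in the free group:
(i) `s_{pq}² = 1`;
(ii) `s_{pq} s_{kl} = s_{kl} s_{pq}` when `[p,q]` and `[k,l]` are disjoint;
(iii) `s_{pq} s_{kl} = s_{uv} s_{pq}` when `[k,l] ⊆ [p,q]`, where `u = p+q−l`, `v = p+q−k`. -/
def cactusRels (n : ℕ) : Set (FreeGroup (CactusGen n)) :=
  { r | (∃ a : CactusGen n, r = .of a * .of a) ∨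
        (∃ a b : CactusGen n, (a.1.2 < b.1.1 ∨ b.1.2 < a.1.1) ∧
          r = .of a * .of b * (.of a)⁻¹ * (.of b)⁻¹) ∨
        (∃ a b c : CactusGen n, a.1.1 ≤ b.1.1 ∧ b.1.2 ≤ a.1.2 ∧
          c.1.1 = a.1.1 + a.1.2 - b.1.2 ∧ c.1.2 = a.1.1 + a.1.2 - b.1.1 ∧
          r = .of a * .of b * (.of a)⁻¹ * (.of c)⁻¹) }

/-- The cactus group `J_n`, presented by generators `s_{pq}` and the relations above. -/
abbrev CactusGroup (n : ℕ) := PresentedGroup (cactusRels n)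

/-- The generator `s_{pq}` of the cactus group `J_n`. -/
def cactusS (n p q : ℕ) (h1 : 1 ≤ p) (h2 : p < q) (h3 : q ≤ n) : CactusGroup n :=
  PresentedGroup.of (sGen n p q h1 h2 h3)

/-- Conjugating `s_{1,q-p+1}` by `s_{1q}` gives `s_{pq}`. -/
theorem cactusS_eq_conj (n p q : ℕ) (h1 : 1 ≤ p) (h2 : p < q) (h3 : q ≤ n) :
    cactusS n p q h1 h2 h3 =
      cactusS n 1 q le_rfl (by omega) h3 *
        cactusS n 1 (q - p + 1) le_rfl (by omega) (by omega) *
        (cactusS n 1 q le_rfl (by omega) h3)⁻¹ := by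
  symm
  rw [← mul_inv_eq_one]
  refine PresentedGroup.one_of_mem (rels := cactusRels n) (Or.inr (Or.inr
    ⟨sGen n 1 q le_rfl (by omega) h3, sGen n 1 (q - p + 1) le_rfl (by omega) (by omega),
      sGen n p q h1 h2 h3, ?_, ?_, ?_, ?_, rfl⟩)) <;> simp only [sGen] <;> omega

/-- The cactus group `J_n` is generated by the elements `s_{1q}` for `2 ≤ q ≤ n`:
the subgroup generated by `{s_{1q} : 2 ≤ q ≤ n}` is the whole group. -/
theorem cactus_generated_by_s1q (n : ℕ) :
    Subgroup.closure { x : CactusGroup n |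
        ∃ (q : ℕ) (h2 : 1 < q) (h3 : q ≤ n), x = cactusS n 1 q le_rfl h2 h3 } = ⊤ := by
  rw [eq_top_iff, ← PresentedGroup.closure_range_of, Subgroup.closure_le]
  rintro _ ⟨⟨⟨p, q⟩, h1, h2, h3⟩, rfl⟩
  change cactusS n p q h1 h2 h3 ∈ Subgroup.closure _
  rw [cactusS_eq_conj]
  have mem (k : ℕ) (hk : 1 < k) (hkn : k ≤ n) : cactusS n 1 k le_rfl hk hkn ∈
      Subgroup.closure { x : CactusGroup n |
        ∃ (q : ℕ) (h2 : 1 < q) (h3 : q ≤ n), x = cactusS n 1 q le_rfl h2 h3 } :=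
    Subgroup.subset_closure ⟨k, hk, hkn, rfl⟩
  exact mul_mem (mul_mem (mem _ _ _) (mem _ _ _)) (inv_mem (mem _ _ _))
end

section
/- Let 1 ≤ p ≤ k < l ≤ q ≤ n, so the interval [k,l] is contained in [p,q]. Then the interval-reversing permutations satisfy the conjugation identity ŝ_{pq} ∘ ŝ_{kl} ∘ ŝ_{pq} = ŝ_{uv}, where u = p+q−l and v = p+q−k. -/
/-- The function underlying the interval-reversing permutation `ŝ_{pq}` of `{1,…,n}`
(realized on `Fin n` via the reindexing `i ↦ i+1`): it sends the 1-based index `j ∈ [p,q]`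
to `p + q - j` and fixes everything else. -/
def srevFun (n p q : ℕ) : Fin n → Fin n := fun i =>
  if h : 1 ≤ p ∧ p ≤ i.val + 1 ∧ i.val + 1 ≤ q ∧ q ≤ n then
    ⟨p + q - (i.val + 1) - 1, by omega⟩
  else i

theorem srevFun_involutive (n p q : ℕ) : Function.Involutive (srevFun n p q) := by
  intro i
  unfold srevFun
  by_cases h : 1 ≤ p ∧ p ≤ i.val + 1 ∧ i.val + 1 ≤ q ∧ q ≤ n
  · rw [dif_pos h, dif_pos]
    · apply Fin.ext
      show p + q - (p + q - (i.val + 1) - 1 + 1) - 1 = i.val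
      omega
    · show 1 ≤ p ∧ p ≤ p + q - (i.val + 1) - 1 + 1 ∧ p + q - (i.val + 1) - 1 + 1 ≤ q ∧ q ≤ n
      omega
  · rw [dif_neg h, dif_neg h]

/-- The interval-reversing permutation `ŝ_{pq} ∈ S_n`. -/
def srev (n p q : ℕ) : Equiv.Perm (Fin n) :=
  Function.Involutive.toPerm _ (srevFun_involutive n p q)

theorem srev_apply_val (n p q : ℕ) (i : Fin n) :
    (srev n p q i).val =
      if 1 ≤ p ∧ p ≤ i.val + 1 ∧ i.val + 1 ≤ q ∧ q ≤ n then p + q - (i.val + 1) - 1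
      else i.val := by
  change (srevFun n p q i).val = _
  unfold srevFun
  split_ifs <;> rfl

/-- Let `1 ≤ p ≤ k < l ≤ q ≤ n`, so the interval `[k,l]` is contained in `[p,q]`.
Then `ŝ_{pq} ∘ ŝ_{kl} ∘ ŝ_{pq} = ŝ_{uv}` where `u = p+q−l` and `v = p+q−k`. -/
theorem srev_conj_nested (n p q k l : ℕ) (h1 : 1 ≤ p) (h2 : p ≤ k) (h3 : k < l)
    (h4 : l ≤ q) (h5 : q ≤ n) :
    srev n p q * srev n k l * srev n p q = srev n (p + q - l) (p + q - k) := by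
  ext i
  have hi := i.isLt
  simp only [Equiv.Perm.mul_apply, srev_apply_val]
  split_ifs <;> omega
end
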